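/- arXiv:2008.09248 — 4 statements merged into one kernel-verified Lean document; each statement's English description precedes it below -/
import Mathlib

section
/- Let Υ > 0 and let P = (P₁,P₂,P₃) be a random point uniformly distributed on the closed ball of radius Υ centered at the origin in ℝ³. Let a, b, c ∈ ℝ be not all zero, set Φ := √(a² + b² + c²) and ε := a·P₁ + b·P₂ + c·P₃. Then for every x with |x| ≤ ΥΦ, the cumulative distribution function of ε satisfies P(ε ≤ x) = 1/2 − x³/(4Υ³Φ³) + 3x/(4ΥΦ). -/
open MeasureTheory Metric

/-- The uniform probability measure on the closed ball of radius `Υ` centered at the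
origin of `ℝ³` (Lebesgue measure restricted to the ball, normalized by its volume). -/
noncomputable def uniformBall (Υ : ℝ) : Measure (EuclideanSpace ℝ (Fin 3)) :=
  (volume (closedBall (0 : EuclideanSpace ℝ (Fin 3)) Υ))⁻¹ •
    (volume : Measure (EuclideanSpace ℝ (Fin 3))).restrict
      (closedBall (0 : EuclideanSpace ℝ (Fin 3)) Υ)


lemma cap_volume (R s : ℝ) (hR : 0 < R) (hs : -R ≤ s) (hs' : s ≤ R) :
    volume {q : EuclideanSpace ℝ (Fin 3) | q 0 ^ 2 + q 1 ^ 2 + q 2 ^ 2 ≤ R ^ 2 ∧ q 0 ≤ s}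
      = ENNReal.ofReal (Real.pi * (R ^ 2 * s - s ^ 3 / 3 + 2 * R ^ 3 / 3)) := by
  have h1 := (PiLp.volume_preserving_ofLp (Fin 3))
  have h2 := (volume_preserving_piFinSuccAbove (fun _ : Fin 3 => ℝ) 0)
  set T : Set (ℝ × (Fin 2 → ℝ)) :=
    {z | z.1 ^ 2 + z.2 0 ^ 2 + z.2 1 ^ 2 ≤ R ^ 2 ∧ z.1 ≤ s} with hT
  have hTm : MeasurableSet T := by
    have m1 : Measurable (fun z : ℝ × (Fin 2 → ℝ) => z.1 ^ 2 + z.2 0 ^ 2 + z.2 1 ^ 2) := by fun_prop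
    have m2 : Measurable (fun z : ℝ × (Fin 2 → ℝ) => z.1) := by fun_prop
    exact (measurableSet_le m1 measurable_const).inter (measurableSet_le m2 measurable_const)
  have h3 := (h2.comp h1).measure_preimage hTm.nullMeasurableSet
  have h4 : {q : EuclideanSpace ℝ (Fin 3) | q 0 ^ 2 + q 1 ^ 2 + q 2 ^ 2 ≤ R ^ 2 ∧ q 0 ≤ s}
      = (⇑(MeasurableEquiv.piFinSuccAbove (fun _ : Fin 3 => ℝ) 0) ∘
          (@WithLp.ofLp 2 (Fin 3 → ℝ))) ⁻¹' T := by
    ext q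
    simp [hT, MeasurableEquiv.piFinSuccAbove, Fin.insertNthEquiv]
    exact fun _ => Iff.rfl
  rw [h4, h3, Measure.volume_eq_prod, Measure.prod_apply hTm]
  have hslice : ∀ t : ℝ, volume (Prod.mk t ⁻¹' T) =
      (Set.Icc (-R) s).indicator (fun t => ENNReal.ofReal (Real.pi * (R ^ 2 - t ^ 2))) t := by
    intro t
    by_cases ht : t ∈ Set.Icc (-R) s
    · rw [Set.indicator_of_mem ht]
      have h0 : 0 ≤ R ^ 2 - t ^ 2 := by nlinarith [ht.1, ht.2]
      have e : (@WithLp.toLp 2 (Fin 2 → ℝ)) ⁻¹' closedBall 0 (√(R ^ 2 - t ^ 2))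
          = Prod.mk t ⁻¹' T := by
        ext r
        simp only [Set.mem_preimage, mem_closedBall, dist_zero_right, hT, Set.mem_ofPred_eq,
          EuclideanSpace.norm_eq, Fin.sum_univ_two, Real.norm_eq_abs, sq_abs]
        rw [Real.sqrt_le_sqrt_iff h0]
        constructor
        · intro h; exact ⟨by linarith, ht.2⟩
        · rintro ⟨h, _⟩; linarith
      rw [← e, (PiLp.volume_preserving_toLp (Fin 2)).measure_preimage
        measurableSet_closedBall.nullMeasurableSet, EuclideanSpace.volume_closedBall_fin_two,
        ← ENNReal.ofReal_pow (Real.sqrt_nonneg _), Real.sq_sqrt h0, mul_comm Real.pi,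
        ENNReal.ofReal_mul h0]
      try rfl
    · rw [Set.indicator_of_notMem ht]
      have e : Prod.mk t ⁻¹' T = ∅ := by
        ext r
        simp only [Set.mem_preimage, hT, Set.mem_ofPred_eq, Set.mem_empty_iff_false, iff_false]
        rintro ⟨h, h'⟩
        apply ht
        refine ⟨?_, h'⟩
        have := abs_le_of_sq_le_sq (a := t) (b := R) (by nlinarith [sq_nonneg (r 0), sq_nonneg (r 1)]) hR.le
        exact (abs_le.mp this).1
      rw [e, measure_empty]
  simp_rw [hslice]
  rw [lintegral_indicator measurableSet_Icc, ← ofReal_integral_eq_lintegral_ofReal]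
  · congr 1
    rw [integral_Icc_eq_integral_Ioc, ← intervalIntegral.integral_of_le hs]
    rw [intervalIntegral.integral_const_mul, intervalIntegral.integral_sub (by simp) (by
      apply Continuous.intervalIntegrable; fun_prop)]
    simp
    ring
  · exact (Continuous.integrableOn_Icc (by fun_prop))
  · filter_upwards [ae_restrict_mem measurableSet_Icc] with t ht
    have : 0 ≤ R ^ 2 - t ^ 2 := by nlinarith [ht.1, ht.2]
    have := Real.pi_pos
    simp only [Pi.zero_apply]
    positivity

/-- CDF of `ε = a·P₁ + b·P₂ + c·P₃` for `P` uniform on the ball of radius `Υ`. -/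
theorem cdf_of_linear_functional_of_uniform_ball
    (Υ : ℝ) (hΥ : 0 < Υ) (a b c : ℝ) (habc : ¬(a = 0 ∧ b = 0 ∧ c = 0))
    (Φ : ℝ) (hΦ : Φ = Real.sqrt (a ^ 2 + b ^ 2 + c ^ 2))
    (x : ℝ) (hx : |x| ≤ Υ * Φ) :
    uniformBall Υ {p : EuclideanSpace ℝ (Fin 3) | a * p 0 + b * p 1 + c * p 2 ≤ x}
      = ENNReal.ofReal
          (1 / 2 - x ^ 3 / (4 * Υ ^ 3 * Φ ^ 3) + 3 * x / (4 * Υ * Φ)) := by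
  have hpos : 0 < a ^ 2 + b ^ 2 + c ^ 2 := by
    by_contra h
    apply habc
    refine ⟨?_, ?_, ?_⟩ <;> nlinarith [sq_nonneg a, sq_nonneg b, sq_nonneg c]
  have hΦ0 : 0 < Φ := hΦ ▸ Real.sqrt_pos.mpr hpos
  have hΦ2 : Φ ^ 2 = a ^ 2 + b ^ 2 + c ^ 2 := by rw [hΦ, Real.sq_sqrt hpos.le]
  have hwn : ‖(!₂[a, b, c] : EuclideanSpace ℝ (Fin 3))‖ = Φ := by
    rw [EuclideanSpace.norm_eq, hΦ]; simp [Fin.sum_univ_three]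
  set u : EuclideanSpace ℝ (Fin 3) := Φ⁻¹ • !₂[a, b, c] with hu
  have hun : ‖u‖ = 1 := by
    rw [hu, norm_smul, hwn, Real.norm_eq_abs, abs_of_pos (inv_pos.mpr hΦ0)]
    field_simp
  obtain ⟨B, hB⟩ := Orthonormal.exists_orthonormalBasis_extension_of_card_eq (𝕜 := ℝ)
    (E := EuclideanSpace ℝ (Fin 3)) (ι := Fin 3) (by simp) (v := fun _ => u) (s := {0})
    (by
      constructor
      · intro i; simpa using hun
      · intro i j hij; exact absurd (Subsingleton.elim i j) hij)
  have hB0 : B 0 = u := hB 0 rfl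
  have hxx := abs_le.mp hx
  have hs1 : -Υ ≤ x / Φ := by rw [le_div_iff₀ hΦ0]; linarith
  have hs2 : x / Φ ≤ Υ := by rw [div_le_iff₀ hΦ0]; linarith
  have hcap := cap_volume Υ (x / Φ) hΥ hs1 hs2
  have hm : MeasurableSet {q : EuclideanSpace ℝ (Fin 3) |
      q 0 ^ 2 + q 1 ^ 2 + q 2 ^ 2 ≤ Υ ^ 2 ∧ q 0 ≤ x / Φ} := by
    have m1 : Measurable (fun q : EuclideanSpace ℝ (Fin 3) => q 0 ^ 2 + q 1 ^ 2 + q 2 ^ 2) := by fun_prop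
    have m2 : Measurable (fun q : EuclideanSpace ℝ (Fin 3) => q 0) := by fun_prop
    exact (measurableSet_le m1 measurable_const).inter (measurableSet_le m2 measurable_const)
  have hmp := (B.measurePreserving_repr).measure_preimage hm.nullMeasurableSet
  have hset : {p : EuclideanSpace ℝ (Fin 3) | a * p 0 + b * p 1 + c * p 2 ≤ x} ∩
      closedBall 0 Υ = B.repr ⁻¹' {q : EuclideanSpace ℝ (Fin 3) |
      q 0 ^ 2 + q 1 ^ 2 + q 2 ^ 2 ≤ Υ ^ 2 ∧ q 0 ≤ x / Φ} := by
    ext p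
    have hn : (B.repr p) 0 ^ 2 + (B.repr p) 1 ^ 2 + (B.repr p) 2 ^ 2 = ‖p‖ ^ 2 := by
      rw [← B.repr.norm_map p, EuclideanSpace.norm_sq_eq, Fin.sum_univ_three]
      simp only [Real.norm_eq_abs, sq_abs]
    have h0 : (B.repr p) 0 = (a * p 0 + b * p 1 + c * p 2) / Φ := by
      rw [B.repr_apply_apply, hB0, hu, real_inner_smul_left]
      simp [PiLp.inner_apply, Fin.sum_univ_three]
      field_simp
      try ring
    simp only [Set.mem_inter_iff, Set.mem_ofPred_eq, mem_closedBall, dist_zero_right,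
      Set.mem_preimage]
    rw [hn, h0, div_le_div_iff_of_pos_right hΦ0, pow_le_pow_iff_left₀ (norm_nonneg _) hΥ.le two_ne_zero,
      and_comm]
  have hm2 : MeasurableSet {p : EuclideanSpace ℝ (Fin 3) | a * p 0 + b * p 1 + c * p 2 ≤ x} :=
    measurableSet_le (by fun_prop) (by fun_prop)
  have hpi := Real.pi_pos
  rw [uniformBall, Measure.smul_apply, Measure.restrict_apply hm2, hset, hmp, hcap,
    EuclideanSpace.volume_closedBall_fin_three, smul_eq_mul,
    ← ENNReal.ofReal_pow hΥ.le, ← ENNReal.ofReal_mul (by positivity),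
    ← ENNReal.ofReal_inv_of_pos (by positivity), ← ENNReal.ofReal_mul (by positivity)]
  congr 1
  field_simp
  ring
end

section
/- Let Υ > 0 and let P = (P₁,P₂,P₃) be a random point uniformly distributed on the closed ball of radius Υ centered at the origin in ℝ³. Let a, b, c ∈ ℝ, set Φ := √(a² + b² + c²) and ε := a·P₁ + b·P₂ + c·P₃. Then for every real t: if tΥΦ ≠ 0 then E[exp(i t ε)] = (3/(tΥΦ)²)·(sin(tΥΦ)/(tΥΦ) − cos(tΥΦ)), and if tΦ = 0 then E[exp(i t ε)] = 1. -/
open MeasureTheory Metric Complex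

/-- The slice of the ball at height `x` has area `π (R² - x²)`. -/
theorem slice_volume (R x : ℝ) :
    (volume {y : Fin 2 → ℝ | x ^ 2 + y 0 ^ 2 + y 1 ^ 2 ≤ R ^ 2}).toReal
      = if x ^ 2 ≤ R ^ 2 then Real.pi * (R ^ 2 - x ^ 2) else 0 := by
  split_ifs with h
  · have hs : 0 ≤ R ^ 2 - x ^ 2 := by linarith
    have hpre : {y : Fin 2 → ℝ | x ^ 2 + y 0 ^ 2 + y 1 ^ 2 ≤ R ^ 2}
        = (WithLp.toLp 2) ⁻¹' (closedBall (0 : EuclideanSpace ℝ (Fin 2))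
          (Real.sqrt (R ^ 2 - x ^ 2))) := by
      ext y
      simp only [Set.mem_ofPred_eq, Set.mem_preimage, mem_closedBall, dist_zero_right,
        EuclideanSpace.norm_eq, Fin.sum_univ_two, Real.norm_eq_abs, sq_abs]
      rw [Real.sqrt_le_sqrt_iff hs]
      constructor <;> intro h <;> linarith
    rw [hpre, (PiLp.volume_preserving_toLp (Fin 2)).measure_preimage
      measurableSet_closedBall.nullMeasurableSet, EuclideanSpace.volume_closedBall_fin_two,
      ENNReal.toReal_mul, ENNReal.toReal_pow, ENNReal.toReal_ofReal (Real.sqrt_nonneg _),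
      ENNReal.toReal_ofReal Real.pi_pos.le, Real.sq_sqrt hs]
    ring
  · have : {y : Fin 2 → ℝ | x ^ 2 + y 0 ^ 2 + y 1 ^ 2 ≤ R ^ 2} = ∅ := by
      ext y
      simp only [Set.mem_ofPred_eq, Set.mem_empty_iff_false, iff_false]
      intro h'
      nlinarith [sq_nonneg (y 0), sq_nonneg (y 1)]
    simp [this]

theorem ball_slice (R : ℝ) (hR : 0 < R) (f : ℝ → ℂ) (hf : Continuous f) :
    ∫ p in closedBall (0 : EuclideanSpace ℝ (Fin 3)) R, f (p 0)
      = ∫ x in (-R)..R, ((Real.pi * (R ^ 2 - x ^ 2) : ℝ) : ℂ) * f x := by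
  let S : Set (ℝ × (Fin 2 → ℝ)) := {z | z.1 ^ 2 + z.2 0 ^ 2 + z.2 1 ^ 2 ≤ R ^ 2}
  have hS : MeasurableSet S := by
    apply IsClosed.measurableSet
    exact isClosed_le (by fun_prop) (by fun_prop)
  let e : EuclideanSpace ℝ (Fin 3) ≃ᵐ ℝ × (Fin 2 → ℝ) :=
    (MeasurableEquiv.toLp 2 (Fin 3 → ℝ)).symm.trans
      (MeasurableEquiv.piFinSuccAbove (fun _ : Fin 3 => ℝ) 0)
  have he : MeasurePreserving e volume volume :=
    (EuclideanSpace.volume_preserving_symm_measurableEquiv_toLp (Fin 3)).trans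
      (volume_preserving_piFinSuccAbove (fun _ : Fin 3 => ℝ) 0)
  have hpre : closedBall (0 : EuclideanSpace ℝ (Fin 3)) R = e ⁻¹' S := by
    ext p
    have : p ∈ e ⁻¹' S ↔ p 0 ^ 2 + p 1 ^ 2 + p 2 ^ 2 ≤ R ^ 2 := Iff.rfl
    rw [this]
    simp only [mem_closedBall, dist_zero_right,
        EuclideanSpace.norm_eq, Fin.sum_univ_three, Real.norm_eq_abs, sq_abs]
    exact Real.sqrt_le_left hR.le
  have hint : IntegrableOn (fun z : ℝ × (Fin 2 → ℝ) => f z.1) S := by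
    rw [← he.integrableOn_comp_preimage e.measurableEmbedding, ← hpre]
    apply ContinuousOn.integrableOn_compact (isCompact_closedBall _ _)
    have : (fun z : ℝ × (Fin 2 → ℝ) => f z.1) ∘ e
        = fun p : EuclideanSpace ℝ (Fin 3) => f (p 0) := rfl
    rw [this]
    fun_prop
  have h1 : ∫ p in closedBall (0 : EuclideanSpace ℝ (Fin 3)) R, f (p 0)
      = ∫ z in S, f z.1 := by
    rw [hpre]
    exact he.setIntegral_preimage_emb e.measurableEmbedding (fun z => f z.1) S
  rw [h1, ← integral_indicator hS, Measure.volume_eq_prod, integral_prod]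
  swap
  · rw [← Measure.volume_eq_prod]
    exact hint.integrable_indicator hS
  have h2 : ∀ x : ℝ, ∫ y : Fin 2 → ℝ, S.indicator (fun z => f z.1) (x, y)
      = (Set.Icc (-R) R).indicator
        (fun x => ((Real.pi * (R ^ 2 - x ^ 2) : ℝ) : ℂ) * f x) x := by
    intro x
    have hT : MeasurableSet {y : Fin 2 → ℝ | x ^ 2 + y 0 ^ 2 + y 1 ^ 2 ≤ R ^ 2} :=
      (isClosed_le (by fun_prop) (by fun_prop)).measurableSet
    have : (fun y : Fin 2 → ℝ => S.indicator (fun z => f z.1) (x, y))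
        = {y : Fin 2 → ℝ | x ^ 2 + y 0 ^ 2 + y 1 ^ 2 ≤ R ^ 2}.indicator (fun _ => f x) := rfl
    rw [this, integral_indicator hT, setIntegral_const, Measure.real, slice_volume]
    have hiff : x ^ 2 ≤ R ^ 2 ↔ x ∈ Set.Icc (-R) R := by
      rw [sq_le_sq, abs_of_pos hR, abs_le, Set.mem_Icc]
    by_cases hx : x ∈ Set.Icc (-R) R
    · rw [if_pos (hiff.2 hx), Set.indicator_of_mem hx, Complex.real_smul]
    · rw [if_neg (fun h => hx (hiff.1 h)), Set.indicator_of_notMem hx, zero_smul]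
  simp_rw [h2]
  rw [integral_indicator measurableSet_Icc, integral_Icc_eq_integral_Ioc,
    intervalIntegral.integral_of_le (by linarith)]

theorem oned_integral (R k : ℝ) (hk : k ≠ 0) :
    ∫ x in (-R)..R, ((Real.pi * (R ^ 2 - x ^ 2) : ℝ) : ℂ) * Complex.exp (I * (k * x : ℝ))
      = ((Real.pi * (4 * Real.sin (k * R) / k ^ 3 - 4 * R * Real.cos (k * R) / k ^ 2) : ℝ) : ℂ) := by
  have hk' : (k : ℂ) ≠ 0 := by exact_mod_cast hk
  set s : ℂ := I * k with hs
  have hs0 : s ≠ 0 := mul_ne_zero I_ne_zero hk'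
  let F : ℂ → ℂ := fun x => Real.pi * (Complex.exp (s * x) *
    ((R ^ 2 - x ^ 2) / s + 2 * x / s ^ 2 - 2 / s ^ 3))
  have hF : ∀ x : ℝ, HasDerivAt (fun x : ℝ => F x)
      (((Real.pi * (R ^ 2 - x ^ 2) : ℝ) : ℂ) * Complex.exp (I * (k * x : ℝ))) x := by
    intro x
    have h1 : HasDerivAt (fun x : ℂ => Complex.exp (s * x)) (Complex.exp (s * x) * (s * 1)) x :=
      ((hasDerivAt_id (x : ℂ)).const_mul s).cexp
    have h2 : HasDerivAt (fun x : ℂ => ((R : ℂ) ^ 2 - x ^ 2) / s + 2 * x / s ^ 2 - 2 / s ^ 3)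
        (-(2 * (x : ℂ)) / s + 2 * 1 / s ^ 2) x := by
      have h3 : HasDerivAt (fun x : ℂ => (R : ℂ) ^ 2 - x ^ 2) (-(2 * (x : ℂ))) x := by
        simpa using (hasDerivAt_pow 2 (x : ℂ)).const_sub ((R : ℂ) ^ 2)
      exact ((h3.div_const s).add
        (((hasDerivAt_id (x : ℂ)).const_mul 2).div_const (s ^ 2))).sub_const _
    have h4 := ((h1.mul h2).const_mul (Real.pi : ℂ)).comp_ofReal
    refine h4.congr_deriv ?_
    have : I * ((k * x : ℝ) : ℂ) = s * x := by push_cast; rw [hs]; ring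
    rw [this]
    push_cast
    field_simp
    ring
  rw [intervalIntegral.integral_eq_sub_of_hasDerivAt (fun x _ => hF x)]
  · have e1 : Complex.exp (s * R) = Complex.cos (k * R) + Complex.sin (k * R) * I := by
      rw [← Complex.exp_mul_I]; congr 1; rw [hs]; ring
    have e2 : Complex.exp (s * (-R : ℝ)) = Complex.cos (k * R) - Complex.sin (k * R) * I := by
      have := Complex.exp_mul_I (-((k : ℂ) * R))
      rw [Complex.cos_neg, Complex.sin_neg] at this
      rw [sub_eq_add_neg, ← neg_mul, ← this]; congr 1; rw [hs]; push_cast; ring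
    have s2 : s ^ 2 = -(k : ℂ) ^ 2 := by rw [hs, mul_pow, I_sq]; ring
    have s3 : s ^ 3 = -(I * (k : ℂ) ^ 3) := by rw [hs, mul_pow, I_pow_three]; ring
    simp only [F]
    rw [e1, e2, s2, s3]
    push_cast
    have hI := I_ne_zero
    field_simp
    ring_nf
  · apply Continuous.intervalIntegrable
    fun_prop

theorem rotate (R : ℝ) (v : EuclideanSpace ℝ (Fin 3)) (hv : v ≠ 0) (f : ℝ → ℂ) :
    ∫ p in closedBall (0 : EuclideanSpace ℝ (Fin 3)) R, f (inner ℝ v p)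
      = ∫ p in closedBall (0 : EuclideanSpace ℝ (Fin 3)) R, f (‖v‖ * p 0) := by
  have hn : ‖v‖ ≠ 0 := norm_ne_zero_iff.2 hv
  obtain ⟨b, hb⟩ := Orthonormal.exists_orthonormalBasis_extension_of_card_eq (𝕜 := ℝ)
    (E := EuclideanSpace ℝ (Fin 3)) (ι := Fin 3) (by simp)
    (v := fun _ => (‖v‖⁻¹ : ℝ) • v) (s := {0}) (by
      constructor
      · intro i
        simp [norm_smul, hn]
      · intro i j hij
        exact absurd (Subsingleton.elim i j) hij)
  have hb0 := hb 0 (by simp)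
  have hpre : closedBall (0 : EuclideanSpace ℝ (Fin 3)) R
      = b.repr ⁻¹' (closedBall (0 : EuclideanSpace ℝ (Fin 3)) R) := by
    ext p; simp
  have h := b.measurePreserving_repr.setIntegral_preimage_emb
    b.repr.toHomeomorph.measurableEmbedding (fun q => f (‖v‖ * q 0))
    (closedBall (0 : EuclideanSpace ℝ (Fin 3)) R)
  rw [← h, ← hpre]
  congr 1
  ext p
  rw [b.repr_apply_apply, hb0, real_inner_smul_left, mul_inv_cancel_left₀ hn]



/-- Characteristic function of `ε = a·P₁ + b·P₂ + c·P₃` for `P` uniform on the ball of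
radius `Υ` : for `tΥΦ ≠ 0` it equals `(3/(tΥΦ)²)(sin(tΥΦ)/(tΥΦ) − cos(tΥΦ))`, and for
`tΦ = 0` it equals `1`. -/
theorem charFun_of_linear_functional_of_uniform_ball
    (Υ : ℝ) (hΥ : 0 < Υ) (a b c : ℝ)
    (Φ : ℝ) (hΦ : Φ = Real.sqrt (a ^ 2 + b ^ 2 + c ^ 2)) (t : ℝ) :
    (t * Υ * Φ ≠ 0 →
      (∫ p : EuclideanSpace ℝ (Fin 3),
          Complex.exp (Complex.I * (t * (a * p 0 + b * p 1 + c * p 2) : ℝ))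
          ∂(uniformBall Υ))
        = ((3 / (t * Υ * Φ) ^ 2 *
            (Real.sin (t * Υ * Φ) / (t * Υ * Φ) - Real.cos (t * Υ * Φ)) : ℝ) : ℂ)) ∧
    (t * Φ = 0 →
      (∫ p : EuclideanSpace ℝ (Fin 3),
          Complex.exp (Complex.I * (t * (a * p 0 + b * p 1 + c * p 2) : ℝ))
          ∂(uniformBall Υ))
        = 1) := by
  have hvol : (volume (closedBall (0 : EuclideanSpace ℝ (Fin 3)) Υ)).toReal
      = Υ ^ 3 * (Real.pi * 4 / 3) := by
    rw [EuclideanSpace.volume_closedBall_fin_three, ENNReal.toReal_mul, ENNReal.toReal_pow,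
      ENNReal.toReal_ofReal hΥ.le, ENNReal.toReal_ofReal (by positivity)]
  have hpi : (Real.pi : ℝ) ≠ 0 := Real.pi_ne_zero
  constructor
  · intro hne
    have ht : t ≠ 0 := by rintro rfl; simp at hne
    have hΦ0 : Φ ≠ 0 := by rintro h; simp [h] at hne
    have hvn : ‖(!₂[a, b, c] : EuclideanSpace ℝ (Fin 3))‖ = Φ := by
      rw [hΦ, EuclideanSpace.norm_eq]
      simp [Fin.sum_univ_three]
    have hv : (!₂[a, b, c] : EuclideanSpace ℝ (Fin 3)) ≠ 0 := by
      rw [← norm_ne_zero_iff, hvn]; exact hΦ0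
    have hr := rotate Υ _ hv (fun x => Complex.exp (Complex.I * (t * x : ℝ)))
    rw [hvn] at hr
    have h1 : ∀ p : EuclideanSpace ℝ (Fin 3),
        inner ℝ (!₂[a, b, c] : EuclideanSpace ℝ (Fin 3)) p = a * p 0 + b * p 1 + c * p 2 := by
      intro p
      simp [PiLp.inner_apply, Fin.sum_univ_three, mul_comm]
    simp only [h1, ← mul_assoc t Φ] at hr
    have hs := ball_slice Υ hΥ (fun x => Complex.exp (Complex.I * (t * Φ * x : ℝ))) (by fun_prop)
    rw [uniformBall, integral_smul_measure, hr, hs, oned_integral Υ (t * Φ) (mul_ne_zero ht hΦ0),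
      ENNReal.toReal_inv, hvol, Complex.real_smul, ← Complex.ofReal_mul]
    congr 1
    rw [show t * Φ * Υ = t * Υ * Φ by ring]
    have := hΥ.ne'
    field_simp
  · intro h0
    have h1 : ∀ p : EuclideanSpace ℝ (Fin 3), t * (a * p 0 + b * p 1 + c * p 2) = 0 := by
      intro p
      rcases mul_eq_zero.1 h0 with h | h
      · simp [h]
      · rw [h] at hΦ
        have h2 := (Real.sqrt_eq_zero (by positivity)).1 hΦ.symm
        have ha : a = 0 := by nlinarith [sq_nonneg a, sq_nonneg b, sq_nonneg c]
        have hb : b = 0 := by nlinarith [sq_nonneg a, sq_nonneg b, sq_nonneg c]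
        have hc : c = 0 := by nlinarith [sq_nonneg a, sq_nonneg b, sq_nonneg c]
        simp [ha, hb, hc]
    simp only [h1]
    rw [uniformBall, integral_smul_measure, setIntegral_const, Measure.real,
      ENNReal.toReal_inv, hvol, Complex.real_smul, Complex.real_smul, ← mul_assoc,
      ← Complex.ofReal_mul, inv_mul_cancel₀ (by positivity)]
    simp
end

section
/- Fix K ≥ 1, an index k ∈ {1,…,K}, reals ρ > 0, σ² > 0, N ≥ 1 (number of BS antennas), and for each i, m ∈ {1,…,K}: η_i > 0, β_i > 0, v_i > 0, w_m > 0, and δ_i ∈ ℝ with sin(πδ_i/2) ≠ 0 for every i ≠ k. For a natural number M ≥ 1 define SINR(M) := N M² η_k ρ β_k / [ N M ρ Σ_{i=1}^{K} η_i β_i / v_i + M ρ (Σ_{i=1}^{K} η_i) Σ_{m=1}^{K} ( β_m/(w_m v_m) + β_m/w_m ) + N ρ Σ_{i≠k} η_i β_i (sin(Mπδ_i/2)/sin(πδ_i/2))² + σ² ]. Then lim_{M → ∞} SINR(M)/M = N η_k β_k / [ N Σ_{i=1}^{K} η_i β_i / v_i + (Σ_{i=1}^{K} η_i) Σ_{m=1}^{K}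 ( β_m/(w_m v_m) + β_m/w_m ) ]. -/
open Filter Topology Real Finset

/-- Corollary 3 of the paper: with a large number `M` of reflecting elements the
individual SINR (perfect location information, orthogonal IRS directions) grows
proportionally to `M`, i.e. `SINR(M)/M` converges to the stated constant. -/
theorem sinr_growth_large_M
    (K : ℕ) (hK : 1 ≤ K) (k : Fin K) (ρ σ2 : ℝ) (hρ : 0 < ρ) (hσ2 : 0 < σ2)
    (N : ℕ) (hN : 1 ≤ N)
    (η β v w : Fin K → ℝ)
    (hη : ∀ i, 0 < η i) (hβ : ∀ i, 0 < β i) (hv : ∀ i, 0 < v i) (hw : ∀ m, 0 < w m)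
    (δ : Fin K → ℝ) (hδ : ∀ i, i ≠ k → Real.sin (π * δ i / 2) ≠ 0)
    (SINR : ℕ → ℝ)
    (hSINR : SINR = fun M : ℕ =>
      (N : ℝ) * (M : ℝ) ^ 2 * η k * ρ * β k /
        ((N : ℝ) * (M : ℝ) * ρ * ∑ i : Fin K, η i * β i / v i
          + (M : ℝ) * ρ * (∑ i : Fin K, η i) *
              ∑ m : Fin K, (β m / (w m * v m) + β m / w m)
          + (N : ℝ) * ρ * ∑ i ∈ Finset.univ.erase k,
              η i * β i * (Real.sin ((M : ℝ) * π * δ i / 2) / Real.sin (π * δ i / 2)) ^ 2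
          + σ2)) :
    Tendsto (fun M : ℕ => SINR M / (M : ℝ)) atTop
      (𝓝 ((N : ℝ) * η k * β k /
        ((N : ℝ) * ∑ i : Fin K, η i * β i / v i
          + (∑ i : Fin K, η i) * ∑ m : Fin K, (β m / (w m * v m) + β m / w m)))) := by
  subst hSINR
  have hNpos : (0 : ℝ) < N := by exact_mod_cast hN
  have hA : 0 < ∑ i : Fin K, η i * β i / v i :=
    Finset.sum_pos (fun i _ => div_pos (mul_pos (hη i) (hβ i)) (hv i)) ⟨k, Finset.mem_univ k⟩
  have hS : 0 < ∑ i : Fin K, η i :=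
    Finset.sum_pos (fun i _ => hη i) ⟨k, Finset.mem_univ k⟩
  have hB : 0 < ∑ m : Fin K, (β m / (w m * v m) + β m / w m) :=
    Finset.sum_pos (fun i _ => add_pos (div_pos (hβ i) (mul_pos (hw i) (hv i)))
      (div_pos (hβ i) (hw i))) ⟨k, Finset.mem_univ k⟩
  have hinv : Tendsto (fun M : ℕ => ((M : ℝ))⁻¹) atTop (𝓝 0) :=
    tendsto_inv_atTop_zero.comp tendsto_natCast_atTop_atTop
  have hE : Tendsto (fun M : ℕ => ∑ i ∈ Finset.univ.erase k,
      (η i * β i * (Real.sin ((M : ℝ) * π * δ i / 2) / Real.sin (π * δ i / 2)) ^ 2)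
        * ((M : ℝ))⁻¹) atTop (𝓝 0) := by
    have h0 : (∑ _i ∈ Finset.univ.erase k, (0 : ℝ)) = 0 := Finset.sum_const_zero
    refine Eq.subst (motive := fun x => Tendsto _ atTop (𝓝 x)) h0 ?_
    refine tendsto_finsetSum _ fun i _ => ?_
    have hc : Tendsto (fun M : ℕ => (η i * β i / Real.sin (π * δ i / 2) ^ 2) * ((M : ℝ))⁻¹)
        atTop (𝓝 0) := by simpa using hinv.const_mul (η i * β i / Real.sin (π * δ i / 2) ^ 2)
    have hηβ := mul_pos (hη i) (hβ i)
    refine squeeze_zero (fun M => by positivity) (fun M => ?_) hc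
    refine mul_le_mul_of_nonneg_right ?_ (by positivity)
    rw [div_pow, ← mul_div_assoc]
    refine div_le_div_of_nonneg_right ?_ (by positivity)
    exact mul_le_of_le_one_right hηβ.le (Real.sin_sq_le_one _)
  generalize (∑ i : Fin K, η i * β i / v i) = A at *
  generalize (∑ i : Fin K, η i) = S at *
  generalize (∑ m : Fin K, (β m / (w m * v m) + β m / w m)) = B at *
  simp only [← Finset.sum_mul] at hE
  have hD : 0 < (N : ℝ) * A + S * B := by positivity
  have hden : Tendsto (fun M : ℕ => ρ * (N * A + S * B) + N * ρ * ((∑ i ∈ Finset.univ.erase k,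
      (η i * β i * (Real.sin ((M : ℝ) * π * δ i / 2) / Real.sin (π * δ i / 2)) ^ 2))
        * ((M : ℝ))⁻¹) + σ2 * ((M : ℝ))⁻¹) atTop (𝓝 (ρ * (N * A + S * B))) := by
    simpa using ((hE.const_mul ((N : ℝ) * ρ)).const_add (ρ * (N * A + S * B))).add
      (hinv.const_mul σ2)
  have hlim := (tendsto_const_nhds (x := (N : ℝ) * η k * ρ * β k)).div hden (by positivity)
  have heq : (N : ℝ) * η k * ρ * β k / (ρ * (N * A + S * B))
      = (N : ℝ) * η k * β k / (N * A + S * B) := by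
    field_simp
  rw [heq] at hlim
  refine hlim.congr' ?_
  filter_upwards [eventually_gt_atTop 0] with M hM
  have hM' : (0 : ℝ) < M := by exact_mod_cast hM
  have hE0 : 0 ≤ ∑ i ∈ Finset.univ.erase k,
      η i * β i * (Real.sin ((M : ℝ) * π * δ i / 2) / Real.sin (π * δ i / 2)) ^ 2 :=
    Finset.sum_nonneg fun i _ => mul_nonneg (mul_pos (hη i) (hβ i)).le (sq_nonneg _)
  simp only [Pi.div_apply]
  generalize (∑ i ∈ Finset.univ.erase k,
      η i * β i * (Real.sin ((M : ℝ) * π * δ i / 2) / Real.sin (π * δ i / 2)) ^ 2) = E at *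
  have h1 : ρ * (N * A + S * B) + N * ρ * (E * ((M : ℝ))⁻¹) + σ2 * ((M : ℝ))⁻¹ ≠ 0 := by
    positivity
  have h2 : (N : ℝ) * M * ρ * A + M * ρ * S * B + N * ρ * E + σ2 ≠ 0 := by positivity
  rw [div_div, div_eq_div_iff h1 (mul_ne_zero h2 hM'.ne')]
  field_simp
end

section
/- Fix K ≥ 1, an index k ∈ {1,…,K}, reals ρ > 0, σ² > 0, natural numbers N ≥ 1 and M ≥ 1, and for each i ∈ {1,…,K}: η_i > 0, a_i > 0, and δ_i ∈ ℝ with sin(πδ_i/2) ≠ 0 for every i ≠ k; write D_i := (sin(Mπδ_i/2)/sin(πδ_i/2))². For v > 0 set β_i(v) := a_i v²/(v+1)² and define SINR(v) := N M² η_k ρ β_k(v) / [ N M ρ Σ_{i=1}^{K} η_i β_i(v) / v + M ρ (Σ_{i=1}^{K} η_i) Σ_{m=1}^{K} ( β_m(v)/v² + β_m(v)/v ) + N ρ Σ_{i≠k} η_i β_i(v) D_i + σ² ]. Then lim_{v → ∞} SINR(v) = N M² η_k ρ a_k / [ N ρ Σ_{i≠k} η_i a_i D_i + σ² ]. -/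
open Filter Topology Real Finset

/-- Corollary 5 of the paper: without NLOS paths (common Rician K-factor `v → ∞`)
the individual SINR (perfect location information, orthogonal IRS directions)
converges to `N M² η_k ρ a_k / (N ρ Σ_{i≠k} η_i a_i D_i + σ²)`. -/
theorem sinr_limit_no_NLOS
    (K : ℕ) (hK : 1 ≤ K) (k : Fin K) (ρ σ2 : ℝ) (hρ : 0 < ρ) (hσ2 : 0 < σ2)
    (N M : ℕ) (hN : 1 ≤ N) (hM : 1 ≤ M)
    (η a : Fin K → ℝ) (hη : ∀ i, 0 < η i) (ha : ∀ i, 0 < a i)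
    (δ : Fin K → ℝ) (hδ : ∀ i, i ≠ k → Real.sin (π * δ i / 2) ≠ 0)
    (D : Fin K → ℝ)
    (hD : D = fun i => (Real.sin ((M : ℝ) * π * δ i / 2) / Real.sin (π * δ i / 2)) ^ 2)
    (β : ℝ → Fin K → ℝ) (hβ : β = fun v i => a i * v ^ 2 / (v + 1) ^ 2)
    (SINR : ℝ → ℝ)
    (hSINR : SINR = fun v : ℝ =>
      (N : ℝ) * (M : ℝ) ^ 2 * η k * ρ * β v k /
        ((N : ℝ) * (M : ℝ) * ρ * ∑ i : Fin K, η i * β v i / v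
          + (M : ℝ) * ρ * (∑ i : Fin K, η i) *
              ∑ m : Fin K, (β v m / v ^ 2 + β v m / v)
          + (N : ℝ) * ρ * ∑ i ∈ Finset.univ.erase k, η i * β v i * D i
          + σ2)) :
    Tendsto SINR atTop
      (𝓝 ((N : ℝ) * (M : ℝ) ^ 2 * η k * ρ * a k /
        ((N : ℝ) * ρ * ∑ i ∈ Finset.univ.erase k, η i * a i * D i + σ2))) := by
  have hinv : Tendsto (fun v : ℝ => v⁻¹) atTop (𝓝 0) := tendsto_inv_atTop_zero
  have hb : ∀ i, Tendsto (fun v => β v i) atTop (𝓝 (a i)) := by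
    intro i
    have h1 : Tendsto (fun v : ℝ => a i / (1 + v⁻¹) ^ 2) atTop (𝓝 (a i / (1 + 0) ^ 2)) :=
      tendsto_const_nhds.div ((tendsto_const_nhds.add hinv).pow 2) (by norm_num)
    have h2 : a i / (1 + 0) ^ 2 = a i := by norm_num
    rw [h2] at h1
    refine h1.congr' ?_
    filter_upwards [eventually_gt_atTop (0 : ℝ)] with v hv
    have hv1 : v + 1 ≠ 0 := by positivity
    rw [hβ]
    field_simp
  have hs1 : Tendsto (fun v => ∑ i : Fin K, η i * β v i / v) atTop
      (𝓝 (∑ i : Fin K, η i * a i * 0)) := by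
    simp only [div_eq_mul_inv]
    exact tendsto_finsetSum _ fun i _ => ((hb i).const_mul (η i)).mul hinv
  have hs2 : Tendsto (fun v => ∑ m : Fin K, (β v m / v ^ 2 + β v m / v)) atTop
      (𝓝 (∑ m : Fin K, (a m * 0 ^ 2 + a m * 0))) := by
    simp only [div_eq_mul_inv, ← inv_pow]
    exact tendsto_finsetSum _ fun i _ => ((hb i).mul (hinv.pow 2)).add ((hb i).mul hinv)
  have hs3 : Tendsto (fun v => ∑ i ∈ Finset.univ.erase k, η i * β v i * D i) atTop
      (𝓝 (∑ i ∈ Finset.univ.erase k, η i * a i * D i)) :=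
    tendsto_finsetSum _ fun i _ => ((hb i).const_mul (η i)).mul_const (D i)
  have hpos : 0 ≤ ∑ i ∈ Finset.univ.erase k, η i * a i * D i := by
    refine Finset.sum_nonneg fun i _ => ?_
    have hDi : 0 ≤ D i := by rw [hD]; exact sq_nonneg _
    exact mul_nonneg (mul_nonneg (hη i).le (ha i).le) hDi
  have hne : (N : ℝ) * ρ * ∑ i ∈ Finset.univ.erase k, η i * a i * D i + σ2 ≠ 0 := by
    positivity
  have hden := (((hs1.const_mul ((N : ℝ) * (M : ℝ) * ρ)).add
    (hs2.const_mul ((M : ℝ) * ρ * (∑ i : Fin K, η i)))).add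
    (hs3.const_mul ((N : ℝ) * ρ))).add_const σ2
  simp only [mul_zero, ne_eq, OfNat.ofNat_ne_zero, not_false_eq_true, zero_pow, add_zero,
    Finset.sum_const_zero, zero_add] at hden
  rw [hSINR]
  exact ((hb k).const_mul ((N : ℝ) * (M : ℝ) ^ 2 * η k * ρ)).div hden hne
end
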